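/- Let n = 2p with p ≥ 2, let C be a circle of the plane, and let A be a similarity-equivariant deterministic oblivious algorithm that solves UTP on C in finite time. Then for every strict biangular configuration P of n points on C and every point x in the support of P, the destination A x P is not the current position of any other robot: A x P ∉ (support of P) \ {x}. -/

import Mathlib

open Real

/-- The consecutive central gaps of angles `θ 0 < θ 1 < ⋯ < θ (n-1) < θ 0 + 2π`. -/
noncomputable def gap (n : ℕ) (θ : Fin n → ℝ) (i : Fin n) : ℝ :=
  if h : (i : ℕ) + 1 < n then θ ⟨(i : ℕ) + 1, h⟩ - θ i
  else θ ⟨0, i.pos⟩ + 2 * π - θ i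

/-- A similarity of the plane (identified with `ℂ`): `f x = s • L x + v` with `s > 0`
and `L` a linear isometry. -/
def IsSimilarity (f : ℂ → ℂ) : Prop :=
  ∃ (s : ℝ) (L : ℂ ≃ₗᵢ[ℝ] ℂ) (v : ℂ), 0 < s ∧ ∀ x, f x = s • L x + v

/-- A deterministic oblivious algorithm is similarity-equivariant if it commutes with
every similarity of the plane. -/
def Equivariant (A : ℂ → Multiset ℂ → ℂ) : Prop :=
  ∀ f : ℂ → ℂ, IsSimilarity f → ∀ (x : ℂ) (m : Multiset ℂ),
    A (f x) (Multiset.map f m) = f (A x m)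

open scoped Classical

/-- The execution of algorithm `A` from initial configuration `x₀` under schedule `S`:
at each step, exactly the robots in `S t` apply `A` to their own position and the
multiset of all current positions; the others stay put. -/
noncomputable def exec (n : ℕ) (A : ℂ → Multiset ℂ → ℂ) (x₀ : Fin n → ℂ)
    (S : ℕ → Set (Fin n)) : ℕ → Fin n → ℂ
  | 0 => x₀
  | t + 1 => fun i =>
      if i ∈ S t then
        A (exec n A x₀ S t i) (Multiset.map (exec n A x₀ S t) Finset.univ.val)
      else exec n A x₀ S t i

/-- A fair schedule: every step activates a nonempty set of robots, and every robot is
activated infinitely often. -/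
def FairSchedule (n : ℕ) (S : ℕ → Set (Fin n)) : Prop :=
  (∀ t, (S t).Nonempty) ∧ ∀ (i : Fin n) (T : ℕ), ∃ t, T ≤ t ∧ i ∈ S t

/-- The positions form a regular `n`-gon on the circle of center `c` and radius `ρ`:
up to a permutation, they are the points of angles `φ + 2πk/n`, `k ∈ Fin n`. -/
def FormsRegularNgon (n : ℕ) (c : ℂ) (ρ : ℝ) (pos : Fin n → ℂ) : Prop :=
  ∃ (φ : ℝ) (σ : Equiv.Perm (Fin n)), ∀ i : Fin n,
    pos (σ i) = c + (ρ : ℂ) * Complex.exp (((φ + 2 * π * ((i : ℕ) : ℝ) / n : ℝ) : ℂ) * Complex.I)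

/-- `A` solves the Uniform Transformation Problem on the circle of center `c` and
radius `ρ` in finite time: from every configuration of `n` distinct points of the
circle and under every fair schedule, all robots stay on the circle forever and at
some time the positions form a regular `n`-gon. -/
def SolvesUTP (n : ℕ) (c : ℂ) (ρ : ℝ) (A : ℂ → Multiset ℂ → ℂ) : Prop :=
  ∀ x₀ : Fin n → ℂ, Function.Injective x₀ → (∀ i, x₀ i ∈ Metric.sphere c ρ) →
    ∀ S : ℕ → Set (Fin n), FairSchedule n S →
      (∀ t i, exec n A x₀ S t i ∈ Metric.sphere c ρ) ∧
      ∃ t, FormsRegularNgon n c ρ (exec n A x₀ S t)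

/-- A strict biangular configuration on the circle of center `c` and radius `ρ`:
`n` points of the circle whose consecutive central gaps, in cyclic angular order,
alternate between two positive values `α ≠ β`. -/
def IsStrictBiangularOn (n : ℕ) (c : ℂ) (ρ : ℝ) (P : Multiset ℂ) : Prop :=
  ∃ (θ : Fin n → ℝ) (α β : ℝ), α ≠ β ∧ 0 < α ∧ 0 < β ∧ StrictMono θ ∧
    (∀ i : Fin n, gap n θ i = if (i : ℕ) % 2 = 0 then α else β) ∧
    P = Multiset.map (fun i => c + (ρ : ℂ) * Complex.exp (((θ i : ℝ) : ℂ) * Complex.I))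
          Finset.univ.val

/-- The point of angle `t` on the circle of center `c` and radius `ρ`. -/
noncomputable def circlePt (c : ℂ) (ρ t : ℝ) : ℂ :=
  c + (ρ : ℂ) * Complex.exp ((t : ℂ) * Complex.I)

theorem circlePt_mem_sphere (c : ℂ) {ρ : ℝ} (hρ : 0 < ρ) (t : ℝ) :
    circlePt c ρ t ∈ Metric.sphere c ρ := by
  simp [circlePt, Complex.norm_exp_ofReal_mul_I, abs_of_pos hρ]

theorem circlePt_eq_iff {c : ℂ} {ρ : ℝ} (hρ : 0 < ρ) {t u : ℝ} :
    circlePt c ρ t = circlePt c ρ u ↔ ∃ m : ℤ, t = u + m * (2 * π) := by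
  have hρ' : (ρ : ℂ) ≠ 0 := by exact_mod_cast hρ.ne'
  rw [circlePt, circlePt, add_right_inj, mul_right_inj' hρ', Complex.exp_eq_exp_iff_exists_int]
  refine exists_congr fun m => ?_
  have h : (u : ℂ) * Complex.I + m * (2 * π * Complex.I)
      = ((u + m * (2 * π) : ℝ) : ℂ) * Complex.I := by push_cast; ring
  rw [h, mul_left_inj' Complex.I_ne_zero, Complex.ofReal_inj]

theorem IsSimilarity.injective {f : ℂ → ℂ} (hf : IsSimilarity f) : Function.Injective f := by
  obtain ⟨s, L, v, hs, h⟩ := hf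
  intro x y hxy
  rw [h, h, add_left_inj] at hxy
  exact L.injective (smul_right_injective ℂ hs.ne' hxy)

/-- The rotation of angle `δ` about `c`. -/
theorem exists_similarity_rotation (c : ℂ) (ρ δ : ℝ) :
    ∃ f, IsSimilarity f ∧ ∀ t, f (circlePt c ρ t) = circlePt c ρ (t + δ) := by
  refine ⟨fun z => c + Complex.exp (δ * Complex.I) * (z - c),
    ⟨1, rotation (Circle.exp δ), c - Complex.exp (δ * Complex.I) * c, one_pos, fun z => ?_⟩,
    fun t => ?_⟩
  · simp only [rotation_apply, Circle.coe_exp, one_smul]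
    ring
  · simp only [circlePt, Complex.ofReal_add, add_mul, Complex.exp_add]
    ring

/-- The reflection about the line through `c` of direction `δ / 2`. -/
theorem exists_similarity_reflection (c : ℂ) (ρ δ : ℝ) :
    ∃ f, IsSimilarity f ∧ ∀ t, f (circlePt c ρ t) = circlePt c ρ (δ - t) := by
  refine ⟨fun z => c + Complex.exp (δ * Complex.I) * (starRingEnd ℂ) (z - c),
    ⟨1, Complex.conjLIE.trans (rotation (Circle.exp δ)),
      c - Complex.exp (δ * Complex.I) * (starRingEnd ℂ) c, one_pos, fun z => ?_⟩, fun t => ?_⟩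
  · simp only [LinearIsometryEquiv.trans_apply, rotation_apply, Circle.coe_exp, one_smul,
      Complex.conjLIE_apply, map_sub]
    ring
  · have h : Complex.exp (((δ - t : ℝ) : ℂ) * Complex.I)
        = Complex.exp (δ * Complex.I) * Complex.exp (-(t * Complex.I)) := by
      rw [← Complex.exp_add]; congr 1; push_cast; ring
    simp only [circlePt, h, add_sub_cancel_left, map_mul, Complex.conj_ofReal,
      ← Complex.exp_conj, Complex.conj_I, mul_neg]
    ring

theorem Multiset.map_eq_self_of_injective {α : Type*} {m : Multiset α} (hm : m.Nodup)
    {f : α → α} (hf : Function.Injective f) (hfm : ∀ x ∈ m, f x ∈ m) : m.map f = m := by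
  refine Multiset.eq_of_le_of_card_le
    ((Multiset.le_iff_subset (hm.map hf)).2 fun y hy => ?_) (by simp)
  obtain ⟨x, hx, rfl⟩ := Multiset.mem_map.1 hy
  exact hfm x hx

theorem Multiset.map_eq_self_of_surjOn {α : Type*} {m : Multiset α} (hm : m.Nodup)
    {f : α → α} (hf : ∀ y ∈ m, ∃ x ∈ m, f x = y) : m.map f = m :=
  (Multiset.eq_of_le_of_card_le
    ((Multiset.le_iff_subset hm).2 fun y hy => Multiset.mem_map.2 (hf y hy)) (by simp)).symm

/-- The symmetries of the plane that preserve `P` act transitively on `P`. -/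
def SymmetryTransitive (P : Multiset ℂ) : Prop :=
  ∀ x ∈ P, ∀ y ∈ P, ∃ f, IsSimilarity f ∧ (∀ z ∈ P, f z ∈ P) ∧ f x = y

/-- If one robot of a symmetry-transitive configuration moves onto an occupied position, then
activating all robots permutes the positions. -/
theorem Equivariant.map_eq_self {A : ℂ → Multiset ℂ → ℂ} (hA : Equivariant A) {P : Multiset ℂ}
    (hP : P.Nodup) (htrans : SymmetryTransitive P) {x : ℂ} (hx : x ∈ P) (hAx : A x P ∈ P) :
    P.map (fun z => A z P) = P := by
  refine Multiset.map_eq_self_of_surjOn hP fun y hy => ?_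
  obtain ⟨f, hf, hfP, hfy⟩ := htrans _ hAx y hy
  refine ⟨f x, hfP x hx, ?_⟩
  have h := hA f hf x P
  rwa [Multiset.map_eq_self_of_injective hP hf.injective hfP, hfy] at h

theorem map_exec_univ {n : ℕ} {A : ℂ → Multiset ℂ → ℂ} {x₀ : Fin n → ℂ} {P : Multiset ℂ}
    (h₀ : Multiset.map x₀ Finset.univ.val = P) (hP : P.map (fun z => A z P) = P) (t : ℕ) :
    Multiset.map (exec n A x₀ (fun _ => Set.univ) t) Finset.univ.val = P := by
  induction t with
  | zero => exact h₀
  | succ t ih =>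
    simp only [exec, Set.mem_univ, if_true, ih]
    have h := congrArg (Multiset.map fun z => A z P) ih
    rwa [Multiset.map_map, hP] at h

/-- Explicit angles of a biangular configuration. -/
theorem biangular_angle {n : ℕ} (hn : 0 < n) {θ : Fin n → ℝ} {α β : ℝ}
    (hgap : ∀ i : Fin n, gap n θ i = if (i : ℕ) % 2 = 0 then α else β) (k : ℕ) :
    (∀ h : 2 * k < n, θ ⟨2 * k, h⟩ = θ ⟨0, hn⟩ + k * (α + β)) ∧
    (∀ h : 2 * k + 1 < n, θ ⟨2 * k + 1, h⟩ = θ ⟨0, hn⟩ + α + k * (α + β)) := by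
  have odd_of_even : ∀ k : ℕ, (∀ h : 2 * k < n, θ ⟨2 * k, h⟩ = θ ⟨0, hn⟩ + k * (α + β)) →
      ∀ h : 2 * k + 1 < n, θ ⟨2 * k + 1, h⟩ = θ ⟨0, hn⟩ + α + k * (α + β) := by
    intro k hk h
    have hg := hgap ⟨2 * k, by omega⟩
    simp only [gap, h, dif_pos, Nat.mul_mod_right, if_true] at hg
    linarith [hk (by omega)]
  induction k with
  | zero => exact ⟨fun h => by simp, odd_of_even 0 fun h => by simp⟩
  | succ k ih =>
    have even : ∀ h : 2 * (k + 1) < n,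
        θ ⟨2 * (k + 1), h⟩ = θ ⟨0, hn⟩ + ((k + 1 : ℕ) : ℝ) * (α + β) := by
      intro h
      have h' : 2 * k + 1 + 1 < n := by omega
      have hg := hgap ⟨2 * k + 1, by omega⟩
      have hmod : ¬ (2 * k + 1) % 2 = 0 := by omega
      simp only [gap, h', dif_pos, hmod, if_false] at hg
      have := ih.2 (by omega)
      have e : (⟨2 * (k + 1), h⟩ : Fin n) = ⟨2 * k + 1 + 1, h'⟩ := rfl
      rw [e]
      push_cast
      linarith
    exact ⟨even, odd_of_even _ even⟩

theorem biangular_sum {p n : ℕ} (hp : 0 < p) (hnp : n = 2 * p) {θ : Fin n → ℝ} {α β : ℝ}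
    (hgap : ∀ i : Fin n, gap n θ i = if (i : ℕ) % 2 = 0 then α else β) :
    p * (α + β) = 2 * π := by
  obtain ⟨q, rfl⟩ : ∃ q, p = q + 1 := ⟨p - 1, by omega⟩
  have hlast := (biangular_angle (by omega) hgap q).2 (by omega)
  have hg := hgap ⟨2 * q + 1, by omega⟩
  have h1 : ¬ 2 * q + 1 + 1 < n := by omega
  have h2 : ¬ (2 * q + 1) % 2 = 0 := by omega
  simp only [gap, h1, dif_neg, h2, if_false, not_false_eq_true] at hg
  push_cast
  linarith

theorem biangular_injective {n : ℕ} {c : ℂ} {ρ : ℝ} (hρ : 0 < ρ) {θ : Fin n → ℝ}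
    (hn : 0 < n) (hθ : StrictMono θ) (hlast : 0 < gap n θ ⟨n - 1, by omega⟩) :
    Function.Injective fun i => circlePt c ρ (θ i) := by
  have hwidth : ∀ i j, θ i - θ j < 2 * π := by
    intro i j
    have h : ¬ n - 1 + 1 < n := by omega
    simp only [gap, h, dif_neg, not_false_eq_true] at hlast
    have hi : θ i ≤ θ ⟨n - 1, by omega⟩ := hθ.monotone (Fin.mk_le_mk.2 (by omega))
    have hj : θ ⟨0, hn⟩ ≤ θ j := hθ.monotone (Fin.mk_le_mk.2 (by omega))
    linarith
  intro i j hij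
  obtain ⟨m, hm⟩ := (circlePt_eq_iff hρ).1 hij
  have h1 : (m : ℝ) < 1 := by
    nlinarith [hwidth i j, pi_pos]
  have h2 : (-1 : ℝ) < m := by
    nlinarith [hwidth j i, pi_pos]
  have hm0 : m = 0 := by
    have : m < 1 := by exact_mod_cast h1
    have : -1 < m := by exact_mod_cast h2
    omega
  refine hθ.injective ?_
  rw [hm, hm0]
  simp

theorem mem_biangular_iff {p n : ℕ} (hp : 0 < p) (hnp : n = 2 * p) {c : ℂ} {ρ : ℝ} (hρ : 0 < ρ)
    {θ : Fin n → ℝ} {α β : ℝ}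
    (hgap : ∀ i : Fin n, gap n θ i = if (i : ℕ) % 2 = 0 then α else β) (z : ℂ) :
    (∃ i, circlePt c ρ (θ i) = z) ↔
      ∃ k : ℤ, circlePt c ρ (θ ⟨0, by omega⟩ + k * (α + β)) = z ∨
        circlePt c ρ (θ ⟨0, by omega⟩ + α + k * (α + β)) = z := by
  have hang := biangular_angle (by omega) hgap
  constructor
  · rintro ⟨⟨i, hi⟩, rfl⟩
    obtain ⟨k, rfl | rfl⟩ := Nat.even_or_odd' i
    · exact ⟨k, Or.inl (by rw [(hang k).1 hi]; simp)⟩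
    · exact ⟨k, Or.inr (by rw [(hang k).2 hi]; simp)⟩
  · rintro ⟨k, hk⟩
    obtain ⟨r, hr⟩ := Int.eq_ofNat_of_zero_le (Int.emod_nonneg k (b := p) (by omega))
    have hrp : r < p := by
      have := Int.emod_lt_of_pos k (b := p) (by omega)
      omega
    have hper : ∀ a : ℝ, circlePt c ρ (a + r * (α + β)) = circlePt c ρ (a + k * (α + β)) := by
      intro a
      refine (circlePt_eq_iff hρ).2 ⟨-(k / p), ?_⟩
      have hk' : (k : ℝ) = p * ((k / p : ℤ) : ℝ) + r := by
        have := Int.mul_ediv_add_emod k p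
        rw [hr] at this
        exact_mod_cast this.symm
      have hs := biangular_sum hp hnp hgap
      rw [hk', ← hs]
      push_cast
      ring
    rcases hk with hk | hk
    · exact ⟨⟨2 * r, by omega⟩, by rw [(hang r).1, hper, hk]⟩
    · exact ⟨⟨2 * r + 1, by omega⟩, by rw [(hang r).2, hper, hk]⟩

theorem symmetryTransitive_of_mem_iff {c : ℂ} {ρ a b s : ℝ} {P : Multiset ℂ}
    (hP : ∀ z, z ∈ P ↔ ∃ k : ℤ, circlePt c ρ (a + k * s) = z ∨ circlePt c ρ (b + k * s) = z) :
    SymmetryTransitive P := by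
  have hrot : ∀ m : ℤ, ∃ f, IsSimilarity f ∧ (∀ z ∈ P, f z ∈ P) ∧
      ∀ t, f (circlePt c ρ t) = circlePt c ρ (t + m * s) := by
    intro m
    obtain ⟨f, hf, hft⟩ := exists_similarity_rotation c ρ (m * s)
    refine ⟨f, hf, fun z hz => ?_, hft⟩
    obtain ⟨k, rfl | rfl⟩ := (hP z).1 hz
    · exact (hP _).2 ⟨k + m, Or.inl (by rw [hft]; congr 1; push_cast; ring)⟩
    · exact (hP _).2 ⟨k + m, Or.inr (by rw [hft]; congr 1; push_cast; ring)⟩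
  have hrefl : ∀ m : ℤ, ∃ f, IsSimilarity f ∧ (∀ z ∈ P, f z ∈ P) ∧
      ∀ t, f (circlePt c ρ t) = circlePt c ρ (a + b + m * s - t) := by
    intro m
    obtain ⟨f, hf, hft⟩ := exists_similarity_reflection c ρ (a + b + m * s)
    refine ⟨f, hf, fun z hz => ?_, hft⟩
    obtain ⟨k, rfl | rfl⟩ := (hP z).1 hz
    · exact (hP _).2 ⟨m - k, Or.inr (by rw [hft]; congr 1; push_cast; ring)⟩
    · exact (hP _).2 ⟨m - k, Or.inl (by rw [hft]; congr 1; push_cast; ring)⟩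
  intro x hx y hy
  obtain ⟨k, rfl | rfl⟩ := (hP x).1 hx <;> obtain ⟨l, rfl | rfl⟩ := (hP y).1 hy
  · obtain ⟨f, hf, hfP, hft⟩ := hrot (l - k)
    exact ⟨f, hf, hfP, by rw [hft]; congr 1; push_cast; ring⟩
  · obtain ⟨f, hf, hfP, hft⟩ := hrefl (l + k)
    exact ⟨f, hf, hfP, by rw [hft]; congr 1; push_cast; ring⟩
  · obtain ⟨f, hf, hfP, hft⟩ := hrefl (l + k)
    exact ⟨f, hf, hfP, by rw [hft]; congr 1; push_cast; ring⟩
  · obtain ⟨f, hf, hfP, hft⟩ := hrot (l - k)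
    exact ⟨f, hf, hfP, by rw [hft]; congr 1; push_cast; ring⟩

/-- In a regular `n`-gon, all angle differences are multiples of `2π / n`. -/
theorem FormsRegularNgon.angle_sub {n : ℕ} (hn : 0 < n) {c : ℂ} {ρ : ℝ} (hρ : 0 < ρ)
    {pos : Fin n → ℂ} (h : FormsRegularNgon n c ρ pos) {i j : Fin n} {t u : ℝ}
    (ht : pos i = circlePt c ρ t) (hu : pos j = circlePt c ρ u) :
    ∃ m : ℤ, n * (t - u) = m * (2 * π) := by
  obtain ⟨φ, σ, hσ⟩ := h
  have key : ∀ (i : Fin n) (t : ℝ), pos i = circlePt c ρ t →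
      ∃ m : ℤ, n * (t - φ) = m * (2 * π) := by
    intro i t ht
    have hi := hσ (σ.symm i)
    rw [Equiv.apply_symm_apply, ht] at hi
    obtain ⟨m, hm⟩ := (circlePt_eq_iff hρ).1 hi
    refine ⟨(σ.symm i : ℕ) + m * n, ?_⟩
    rw [hm]
    have hn' : (n : ℝ) ≠ 0 := by exact_mod_cast hn.ne'
    push_cast
    field_simp
    ring
  obtain ⟨m, hm⟩ := key i t ht
  obtain ⟨l, hl⟩ := key j u hu
  refine ⟨m - l, ?_⟩
  push_cast
  linarith

/-- If a similarity-equivariant deterministic oblivious algorithm `A` solves UTP in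
finite time, then in a strict biangular circle no activated robot moves onto the
current position of another robot. -/
theorem UTP_strict_biangular_no_collision (p n : ℕ) (hp : 2 ≤ p) (hnp : n = 2 * p)
    (c : ℂ) (ρ : ℝ) (hρ : 0 < ρ)
    (A : ℂ → Multiset ℂ → ℂ) (hA : Equivariant A) (hsolve : SolvesUTP n c ρ A)
    (P : Multiset ℂ) (hP : IsStrictBiangularOn n c ρ P) :
    ∀ x ∈ P, ∀ y ∈ P, y ≠ x → A x P ≠ y := by
  obtain ⟨θ, α, β, hαβ, hα, hβ, hθ, hgap, hPmap⟩ := hP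
  intro x hx y hy _ hAxy
  have hn : 0 < n := by omega
  have hsum := biangular_sum (by omega) hnp hgap
  have hinj : Function.Injective fun i => circlePt c ρ (θ i) := by
    refine biangular_injective hρ hn hθ ?_
    rw [hgap]
    split_ifs <;> assumption
  have hPmap' : Multiset.map (fun i => circlePt c ρ (θ i)) Finset.univ.val = P := hPmap.symm
  have hnodup : P.Nodup := hPmap' ▸ Finset.univ.nodup.map hinj
  have hmem : ∀ z, z ∈ P ↔ ∃ i, circlePt c ρ (θ i) = z := by
    intro z
    simp [← hPmap']
  have htrans : SymmetryTransitive P := symmetryTransitive_of_mem_iff fun z =>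
    (hmem z).trans (mem_biangular_iff (by omega) hnp hρ hgap z)
  have hfix := hA.map_eq_self hnodup htrans hx (hAxy ▸ hy)
  have hfair : FairSchedule n fun _ => Set.univ :=
    ⟨fun _ => ⟨⟨0, hn⟩, trivial⟩, fun _ T => ⟨T, le_rfl, trivial⟩⟩
  obtain ⟨-, t, hreg⟩ := hsolve _ hinj (fun i => circlePt_mem_sphere c hρ (θ i)) _ hfair
  have hpos : ∀ i, ∃ j, exec n A (fun i => circlePt c ρ (θ i)) (fun _ => Set.univ) t j
      = circlePt c ρ (θ i) := by
    intro i
    have h := (hmem _).2 ⟨i, rfl⟩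
    rw [← map_exec_univ hPmap' hfix t] at h
    simpa using h
  obtain ⟨j₀, hj₀⟩ := hpos ⟨0, hn⟩
  obtain ⟨j₁, hj₁⟩ := hpos ⟨1, by omega⟩
  obtain ⟨m, hm⟩ := hreg.angle_sub hn hρ hj₁ hj₀
  have hθ₁ := (biangular_angle hn hgap 0).2 (by omega)
  simp only [Nat.mul_zero, Nat.zero_add, Nat.cast_zero, zero_mul, add_zero] at hθ₁
  have hp' : (0 : ℝ) < p := by exact_mod_cast (by omega : 0 < p)
  rw [hθ₁, add_sub_cancel_left, hnp] at hm
  push_cast at hm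
  have hpα := mul_pos hp' hα
  have hpβ := mul_pos hp' hβ
  have hm0 : (0 : ℝ) < m := by
    by_contra! h
    nlinarith [pi_pos]
  have hm2 : (m : ℝ) < 2 := by
    by_contra! h
    nlinarith [pi_pos]
  have hm1 : m = 1 := by
    have : 0 < m := by exact_mod_cast hm0
    have : m < 2 := by exact_mod_cast hm2
    omega
  rw [hm1, Int.cast_one, one_mul] at hm
  exact hαβ (mul_left_cancel₀ hp'.ne' (by linarith))
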